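/- Let P be an SQLP(R,D) program and T_R(P) its transformed QLP(D) program. For all terms t, s in P's signature and all d ∈ D ∖ {⊥}: if T_R(P) ⊢_{QHL(D)} (t ∼ s)#d, then d ⊑ R(t,s). -/

import Mathlib

structure QualDom (D : Type*) [Lattice D] [BoundedOrder D] where
  att : D → D → D
  att_assoc : ∀ a b c : D, att (att a b) c = att a (att b c)
  att_comm : ∀ a b : D, att a b = att b a
  att_mono : ∀ a b c d : D, a ≤ b → c ≤ d → att a c ≤ att b d
  att_top : ∀ a : D, att a ⊤ = a
  att_bot : ∀ a : D, att a ⊥ = ⊥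
  att_strict : ∀ a b : D, a ≠ ⊥ → a ≠ ⊤ → b ≠ ⊥ → b ≠ ⊤ → att a b < b
  att_distrib_inf : ∀ a b c : D, att a (b ⊓ c) = att a b ⊓ att a c

mutual
  inductive Term (C : Type) (ar : C → ℕ) : Type where
    | var : ℕ → Term C ar
    | app : (c : C) → TermVec C ar (ar c) → Term C ar
  inductive TermVec (C : Type) (ar : C → ℕ) : ℕ → Type where
    | nil : TermVec C ar 0
    | cons {n : ℕ} : Term C ar → TermVec C ar n → TermVec C ar (n + 1)
end

def Subst (C : Type) (ar : C → ℕ) : Type := ℕ → Term C ar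

mutual
  def Term.subst {C : Type} {ar : C → ℕ} : Term C ar → Subst C ar → Term C ar
    | .var i, θ => θ i
    | .app c ts, θ => .app c (ts.subst θ)
  def TermVec.subst {C : Type} {ar : C → ℕ} :
      ∀ {n : ℕ}, TermVec C ar n → Subst C ar → TermVec C ar n
    | _, .nil, _ => .nil
    | _, .cons t ts, θ => .cons (t.subst θ) (ts.subst θ)
end

structure Atom (C Pd : Type) (ar : C → ℕ) (par : Pd → ℕ) : Type where
  pred : Pd
  args : TermVec C ar (par pred)

def Atom.subst {C Pd : Type} {ar : C → ℕ} {par : Pd → ℕ}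
    (A : Atom C Pd ar par) (θ : Subst C ar) : Atom C Pd ar par :=
  ⟨A.pred, A.args.subst θ⟩

structure SimRel (C Pd : Type) (ar : C → ℕ) (par : Pd → ℕ) (D : Type)
    [Lattice D] [BoundedOrder D] where
  simC : C → C → D
  simP : Pd → Pd → D
  simC_refl : ∀ c, simC c c = ⊤
  simC_symm : ∀ c c', simC c c' = simC c' c
  simC_trans : ∀ c c' c'', simC c c' ⊓ simC c' c'' ≤ simC c c''
  simP_refl : ∀ p, simP p p = ⊤
  simP_symm : ∀ p p', simP p p' = simP p' p
  simP_trans : ∀ p p' p'', simP p p' ⊓ simP p' p'' ≤ simP p p''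
  simC_arity : ∀ c c', simC c c' ≠ ⊥ → ar c = ar c'
  simP_arity : ∀ p p', simP p p' ≠ ⊥ → par p = par p'

variable {C Pd : Type} {ar : C → ℕ} {par : Pd → ℕ} {D : Type} [Lattice D] [BoundedOrder D]

mutual
  def termSim (R : SimRel C Pd ar par D) : Term C ar → Term C ar → D
    | .var i, .var j => if i = j then ⊤ else ⊥
    | .app c ts, .app c' ts' => R.simC c c' ⊓ vecSim R ts ts'
    | _, _ => ⊥
  def vecSim (R : SimRel C Pd ar par D) :
      ∀ {n m : ℕ}, TermVec C ar n → TermVec C ar m → D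
    | _, _, .nil, .nil => ⊤
    | _, _, .cons t ts, .cons s ss => termSim R t s ⊓ vecSim R ts ss
    | _, _, _, _ => ⊥
end

def atomSim (R : SimRel C Pd ar par D) (A A' : Atom C Pd ar par) : D :=
  R.simP A.pred A'.pred ⊓ vecSim R A.args A'.args

mutual
  def Term.maxVar {C : Type} {ar : C → ℕ} : Term C ar → ℕ
    | .var i => i + 1
    | .app _ ts => ts.maxVar
  def TermVec.maxVar {C : Type} {ar : C → ℕ} : ∀ {n : ℕ}, TermVec C ar n → ℕ
    | _, .nil => 0
    | _, .cons t ts => max t.maxVar ts.maxVar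
end

mutual
  def linTerm {C : Type} {ar : C → ℕ} :
      Term C ar → List ℕ → ℕ → Term C ar × List ℕ × ℕ × List (ℕ × ℕ)
    | .var x, seen, fresh =>
        if x ∈ seen then (.var fresh, seen, fresh + 1, [(x, fresh)])
        else (.var x, x :: seen, fresh, [])
    | .app c ts, seen, fresh =>
        let r := linVec ts seen fresh
        (.app c r.1, r.2.1, r.2.2.1, r.2.2.2)
  def linVec {C : Type} {ar : C → ℕ} :
      ∀ {n : ℕ}, TermVec C ar n → List ℕ → ℕ → TermVec C ar n × List ℕ × ℕ × List (ℕ × ℕ)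
    | _, .nil, seen, fresh => (.nil, seen, fresh, [])
    | _, .cons t ts, seen, fresh =>
        let r1 := linTerm t seen fresh
        let r2 := linVec ts r1.2.1 r1.2.2.1
        (.cons r1.1 r2.1, r2.2.1, r2.2.2.1, r1.2.2.2 ++ r2.2.2.2)
end

def linAtomFrom (A : Atom C Pd ar par) (start : ℕ) : Atom C Pd ar par × List (ℕ × ℕ) :=
  let r := linVec A.args [] start
  (⟨A.pred, r.1⟩, r.2.2.2)

def linAtom (A : Atom C Pd ar par) : Atom C Pd ar par × List (ℕ × ℕ) :=
  linAtomFrom A A.args.maxVar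

def infList (l : List D) : D := l.foldr (· ⊓ ·) ⊤

def condsInf (R : SimRel C Pd ar par D) (θ : Subst C ar) (conds : List (ℕ × ℕ)) : D :=
  infList (conds.map fun p => termSim R (θ p.1) (θ p.2))

def RInstAtom (R : SimRel C Pd ar par D) (A A' : Atom C Pd ar par) (δ : D) : Prop :=
  ∃ (As : Atom C Pd ar par) (θ : Subst C ar),
    A' = As.subst θ ∧
    δ = atomSim R (linAtom A).1 As ⊓ condsInf R θ (linAtom A).2 ∧
    δ ≠ ⊥

structure Clause (C Pd : Type) (ar : C → ℕ) (par : Pd → ℕ) (D : Type) : Type where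
  head : Atom C Pd ar par
  att : D
  body : List (Atom C Pd ar par)

def Clause.maxVar (Cl : Clause C Pd ar par D) : ℕ :=
  max Cl.head.args.maxVar (Cl.body.foldr (fun B m => max B.args.maxVar m) 0)

def Clause.linHead (Cl : Clause C Pd ar par D) : Atom C Pd ar par × List (ℕ × ℕ) :=
  linAtomFrom Cl.head Cl.maxVar

def RInstClause (R : SimRel C Pd ar par D) (Cl Cl' : Clause C Pd ar par D) (δ : D) : Prop :=
  ∃ (As : Atom C Pd ar par) (θ : Subst C ar),
    δ = atomSim R Cl.linHead.1 As ⊓ condsInf R θ Cl.linHead.2 ∧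
    δ ≠ ⊥ ∧
    Cl' = ⟨As.subst θ, Cl.att, Cl.body.map (Atom.subst · θ)⟩

def entailsD (A : Atom C Pd ar par) (d : D) (A' : Atom C Pd ar par) (d' : D) : Prop :=
  ∃ θ : Subst C ar, A' = A.subst θ ∧ d' ≤ d

def entailsRD (R : SimRel C Pd ar par D) (Q : QualDom D) (A : Atom C Pd ar par) (d : D)
    (A' : Atom C Pd ar par) (d' : D) : Prop :=
  ∃ δ : D, RInstAtom R A A' δ ∧ d' ≤ Q.att d δ

def QAtom (C Pd : Type) (ar : C → ℕ) (par : Pd → ℕ) (D : Type)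
    [Lattice D] [BoundedOrder D] : Type :=
  {p : Atom C Pd ar par × D // p.2 ≠ ⊥}

def IsInterp (R : SimRel C Pd ar par D) (Q : QualDom D)
    (I : Set (QAtom C Pd ar par D)) : Prop :=
  ∀ a ∈ I, ∀ b : QAtom C Pd ar par D, entailsRD R Q a.1.1 a.1.2 b.1.1 b.1.2 → b ∈ I

def memQ (I : Set (QAtom C Pd ar par D)) (A : Atom C Pd ar par) (d : D) : Prop :=
  ∃ q ∈ I, q.1 = (A, d)

inductive SQHL (R : SimRel C Pd ar par D) (Q : QualDom D)
    (Pr : List (Clause C Pd ar par D)) : Atom C Pd ar par → D → Prop where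
  | mp (Cl : Clause C Pd ar par D) (hCl : Cl ∈ Pr) (Cl' : Clause C Pd ar par D) (δ : D)
      (ds : List D) (d' : D)
      (hinst : RInstClause R Cl Cl' δ)
      (hlen : ds.length = Cl'.body.length)
      (hprem : ∀ (i : ℕ) (h1 : i < Cl'.body.length) (h2 : i < ds.length),
        SQHL R Q Pr (Cl'.body.get ⟨i, h1⟩) (ds.get ⟨i, h2⟩))
      (hd' : d' ≠ ⊥)
      (hle : d' ≤ Q.att Cl.att (δ ⊓ infList ds)) :
      SQHL R Q Pr Cl'.head d'

def IsClauseModel (R : SimRel C Pd ar par D) (Q : QualDom D)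
    (I : Set (QAtom C Pd ar par D)) (Cl : Clause C Pd ar par D) : Prop :=
  ∀ (Cl' : Clause C Pd ar par D) (δ : D), RInstClause R Cl Cl' δ →
    ∀ ds : List D, ds.length = Cl'.body.length →
      (∀ (i : ℕ) (h1 : i < Cl'.body.length) (h2 : i < ds.length),
        memQ I (Cl'.body.get ⟨i, h1⟩) (ds.get ⟨i, h2⟩)) →
      ∀ e : D, e = Q.att Cl.att (δ ⊓ infList ds) → e ≠ ⊥ → memQ I Cl'.head e

def IsModel (R : SimRel C Pd ar par D) (Q : QualDom D)
    (Pr : List (Clause C Pd ar par D)) (I : Set (QAtom C Pd ar par D)) : Prop :=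
  ∀ Cl ∈ Pr, IsClauseModel R Q I Cl

def ExtP (Pd : Type) (D : Type) : Type := Pd ⊕ Unit ⊕ D

def extPar (par : Pd → ℕ) (D : Type) : ExtP Pd D → ℕ :=
  Sum.elim par (Sum.elim (fun _ => 2) (fun _ => 0))

def Atom.embed (A : Atom C Pd ar par) : Atom C (ExtP Pd D) ar (extPar par D) :=
  ⟨Sum.inl A.pred, A.args⟩

def simAtom (t s : Term C ar) : Atom C (ExtP Pd D) ar (extPar par D) :=
  ⟨Sum.inr (Sum.inl ()), .cons t (.cons s .nil)⟩

def payAtom (w : D) : Atom C (ExtP Pd D) ar (extPar par D) :=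
  ⟨Sum.inr (Sum.inr w), .nil⟩

def condAtoms (conds : List (ℕ × ℕ)) : List (Atom C (ExtP Pd D) ar (extPar par D)) :=
  conds.map fun p => simAtom (.var p.1) (.var p.2)

def varVec (C : Type) (ar : C → ℕ) : ℕ → (n : ℕ) → TermVec C ar n
  | _, 0 => .nil
  | start, n + 1 => .cons (.var start) (varVec C ar (start + 1) n)

def simConds (n : ℕ) : List (Atom C (ExtP Pd D) ar (extPar par D)) :=
  (List.range n).map fun i => simAtom (.var i) (.var (n + i))

def transPS (R : SimRel C Pd ar par D) (Pr : List (Clause C Pd ar par D)) :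
    Set (Clause C (ExtP Pd D) ar (extPar par D) D) :=
  {Cl' | ∃ Cl ∈ Pr, ∃ H' : Atom C Pd ar par,
    atomSim R (Clause.linHead Cl).1 H' ≠ ⊥ ∧
    Cl' = ⟨Atom.embed H', Cl.att,
      payAtom (atomSim R (Clause.linHead Cl).1 H') ::
        (condAtoms (Clause.linHead Cl).2 ++ Cl.body.map Atom.embed)⟩}

def transSim (R : SimRel C Pd ar par D) :
    Set (Clause C (ExtP Pd D) ar (extPar par D) D) :=
  {⟨simAtom (.var 0) (.var 0), ⊤, []⟩} ∪
  {Cl' | ∃ c c' : C, R.simC c c' ≠ ⊥ ∧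
    Cl' = ⟨simAtom (.app c (varVec C ar 0 (ar c))) (.app c' (varVec C ar (ar c) (ar c'))), ⊤,
           payAtom (R.simC c c') :: simConds (ar c)⟩}

def payWeights (R : SimRel C Pd ar par D) (Pr : List (Clause C Pd ar par D)) : Set D :=
  {w | ∃ Cl ∈ Pr, ∃ H' : Atom C Pd ar par,
      atomSim R (Clause.linHead Cl).1 H' ≠ ⊥ ∧ w = atomSim R (Clause.linHead Cl).1 H'} ∪
  {w | ∃ c c' : C, R.simC c c' ≠ ⊥ ∧ w = R.simC c c'}

def transPay (R : SimRel C Pd ar par D) (Pr : List (Clause C Pd ar par D)) :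
    Set (Clause C (ExtP Pd D) ar (extPar par D) D) :=
  {Cl' | ∃ w ∈ payWeights R Pr, Cl' = ⟨payAtom w, w, []⟩}

def transProg (R : SimRel C Pd ar par D) (Pr : List (Clause C Pd ar par D)) :
    Set (Clause C (ExtP Pd D) ar (extPar par D) D) :=
  transPS R Pr ∪ transSim R ∪ transPay R Pr

inductive QHL {Pd' : Type} {par' : Pd' → ℕ} (Q : QualDom D)
    (Pr : Set (Clause C Pd' ar par' D)) : Atom C Pd' ar par' → D → Prop where
  | mp (Cl : Clause C Pd' ar par' D) (hCl : Cl ∈ Pr) (θ : Subst C ar) (ds : List D) (d' : D)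
      (hlen : ds.length = Cl.body.length)
      (hprem : ∀ (i : ℕ) (h1 : i < Cl.body.length) (h2 : i < ds.length),
        QHL Q Pr ((Cl.body.get ⟨i, h1⟩).subst θ) (ds.get ⟨i, h2⟩))
      (hd' : d' ≠ ⊥)
      (hle : d' ≤ Q.att Cl.att (infList ds)) :
      QHL Q Pr (Cl.head.subst θ) d'

theorem infList_le_of_mem {l : List D} {x : D} (hx : x ∈ l) : infList l ≤ x := by
  induction l with
  | nil => simp at hx
  | cons y l ih =>
    rcases List.mem_cons.1 hx with rfl | hx
    · exact inf_le_left
    · exact inf_le_right.trans (ih hx)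

mutual
  theorem termSim_refl (R : SimRel C Pd ar par D) : ∀ t : Term C ar, termSim R t t = ⊤
    | .var i => by simp [termSim]
    | .app c ts => by simp [termSim, R.simC_refl, vecSim_refl R ts]
  theorem vecSim_refl (R : SimRel C Pd ar par D) :
      ∀ {n : ℕ} (ts : TermVec C ar n), vecSim R ts ts = ⊤
    | _, .nil => by simp [vecSim]
    | _, .cons t ts => by simp [vecSim, termSim_refl R t, vecSim_refl R ts]
end

theorem le_vecSim_varVec_subst (R : SimRel C Pd ar par D) (θ : Subst C ar) (d : D) (n a b : ℕ)
    (h : ∀ i < n, d ≤ termSim R (θ (a + i)) (θ (b + i))) :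
    d ≤ vecSim R ((varVec C ar a n).subst θ) ((varVec C ar b n).subst θ) := by
  induction n generalizing a b with
  | zero => simp [varVec, TermVec.subst, vecSim]
  | succ n ih =>
    simp only [varVec, TermVec.subst, vecSim, Term.subst]
    refine le_inf (h 0 n.succ_pos) (ih _ _ fun i hi => ?_)
    simpa only [add_assoc, add_comm 1] using h (i + 1) (Nat.succ_lt_succ hi)

theorem simAtom_injective {t s t' s' : Term C ar}
    (h : (simAtom t s : Atom C (ExtP Pd D) ar (extPar par D)) = simAtom t' s') :
    t = t' ∧ s = s' := by
  have h' := eq_of_heq (Atom.mk.inj h).2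
  injection h' with _ ht hs
  injection hs with _ hs _
  exact ⟨ht, hs⟩

theorem payAtom_injective {w w' : D}
    (h : (payAtom w : Atom C (ExtP Pd D) ar (extPar par D)) = payAtom w') : w = w' :=
  Sum.inr.inj (Sum.inr.inj (Atom.mk.inj h).1)

/-- `d` is at most the similarity expressed by `A` if `A` is a similarity atom, and at most `w`
if `A` is `pay_w`. -/
def SimPayBound (R : SimRel C Pd ar par D) (A : Atom C (ExtP Pd D) ar (extPar par D)) (d : D) :
    Prop :=
  (∀ t s : Term C ar, A = simAtom t s → d ≤ termSim R t s) ∧ ∀ w : D, A = payAtom w → d ≤ w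

theorem QHL.simPayBound {Q : QualDom D} {R : SimRel C Pd ar par D}
    {Pr : List (Clause C Pd ar par D)} {A : Atom C (ExtP Pd D) ar (extPar par D)} {d : D}
    (h : QHL Q (transProg R Pr) A d) : SimPayBound R A d := by
  induction h with
  | mp Cl hCl θ ds d' hlen hprem hd' hle ih =>
    have body_bound : ∀ (B : Atom C (ExtP Pd D) ar (extPar par D)) (x : D), B ∈ Cl.body →
        (∀ e, SimPayBound R (B.subst θ) e → e ≤ x) → infList ds ≤ x := by
      intro B x hB hx
      obtain ⟨i, hi, rfl⟩ := List.getElem_of_mem hB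
      have hi' : i < ds.length := hlen ▸ hi
      exact (infList_le_of_mem (List.getElem_mem hi')).trans (hx _ (ih i hi hi'))
    rcases hCl with (⟨Cl₀, _, H', _, rfl⟩ | rfl | ⟨c, c', hc, rfl⟩) | ⟨w, _, rfl⟩
    · refine ⟨fun t s h => ?_, fun w h => ?_⟩
      · exact nomatch congrArg Atom.pred h
      · exact nomatch congrArg Atom.pred h
    · refine ⟨fun t s h => ?_, fun w h => ?_⟩
      · obtain ⟨rfl, rfl⟩ := simAtom_injective (t := θ 0) (s := θ 0) h
        simp [termSim_refl]
      · exact nomatch Sum.inr.inj (congrArg Atom.pred h)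
    · refine ⟨fun t s h => ?_, fun w h => ?_⟩
      · obtain ⟨rfl, rfl⟩ := simAtom_injective
          (t := .app c ((varVec C ar 0 (ar c)).subst θ))
          (s := .app c' ((varVec C ar (ar c) (ar c')).subst θ)) h
        rw [Q.att_comm, Q.att_top] at hle
        rw [termSim]
        refine hle.trans (le_inf ?_ ?_)
        · exact body_bound (payAtom (R.simC c c')) _ (by simp) fun e he => he.2 _ rfl
        · rw [← R.simC_arity c c' hc]
          refine le_vecSim_varVec_subst R θ _ _ _ _ fun i hi => ?_
          refine body_bound (simAtom (.var i) (.var (ar c + i))) _ ?_ fun e he => ?_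
          · exact List.mem_cons_of_mem _ (List.mem_map.2 ⟨i, List.mem_range.2 hi, rfl⟩)
          · rw [zero_add]
            exact he.1 _ _ rfl
      · exact nomatch Sum.inr.inj (congrArg Atom.pred h)
    · refine ⟨fun t s h => ?_, fun w' h => ?_⟩
      · exact nomatch Sum.inr.inj (congrArg Atom.pred h)
      · obtain rfl := payAtom_injective (w := w) h
        have hds : ds = [] := List.length_eq_zero_iff.1 hlen
        simpa [hds, infList, Q.att_top] using hle

/-- Soundness of the emulation of similarity by the transformed program: for every
`SQLP(R,D)` program `Pr`, all terms `t`, `s` of `Pr`'s signature and all `d ≠ ⊥`,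
if `T_R(Pr) ⊢_QHL(D) (t ∼ s)#d` then `d ≤ R(t,s)`. -/
theorem transProg_sim_sound {C Pd : Type} {ar : C → ℕ} {par : Pd → ℕ}
    {D : Type} [Lattice D] [BoundedOrder D] (Q : QualDom D) (R : SimRel C Pd ar par D)
    (Pr : List (Clause C Pd ar par D)) (hPr : ∀ Cl ∈ Pr, Cl.att ≠ ⊥)
    (t s : Term C ar) (d : D) (hd : d ≠ ⊥)
    (h : QHL Q (transProg R Pr) (simAtom t s) d) :
    d ≤ termSim R t s := by
  exact (QHL.simPayBound h).1 t s rfl
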